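/- Let A = (Q, Σ, δ) be a strongly connected partial DFA with n states, let A^F be its fixing automaton with minimal rank r, and let r' be the minimal non-zero rank of A. If there exists a word of rank r and length at most (n − r)² in A^F (i.e., the rank conjecture holds for A^F), then there exists a word of rank r' and length at most (n − r')² in A (i.e., the rank conjecture holds for A). -/

import Mathlib

open scoped Classical

section Defs

variable {Q A : Type*}

/-- Action of a word in a partial DFA with transition function `δ`
(`none` means the undefined value ⊥). -/
def stepWord (δ : Q → A → Option Q) : Q → List A → Option Q
  | q, [] => some q
  | q, a :: w => (δ q a).bind (fun p => stepWord δ p w)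

/-- The image `δ(S, w)` of a set of states under the action of a word. -/
def img (δ : Q → A → Option Q) (S : Set Q) (w : List A) : Set Q :=
  {p | ∃ q ∈ S, stepWord δ q w = some p}

/-- The inseparability equivalence `p ≡ q`. -/
def Insep (δ : Q → A → Option Q) (p q : Q) : Prop :=
  ∀ u : List A, (stepWord δ p u).isSome ↔ (stepWord δ q u).isSome

/-- `κ(S)`: the number of inseparability classes intersecting `S`. -/
noncomputable def kappa (δ : Q → A → Option Q) (S : Set Q) : ℕ :=
  {C : Set Q | ∃ p ∈ S, C = {q | Insep δ p q}}.ncard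

def StronglyConnected (δ : Q → A → Option Q) : Prop :=
  ∀ p q : Q, ∃ w : List A, stepWord δ p w = some q

/-- The transition function of the fixing automaton `A^F`. -/
def fixDelta (δ : Q → A → Option Q) (q : Q) (a : A) : Q := (δ q a).getD q

/-- Action of a word in a complete DFA. -/
def stepWordC (δc : Q → A → Q) (q : Q) (w : List A) : Q := w.foldl δc q

/-- The image of a set of states under the action of a word in a complete DFA. -/
def imgC (δc : Q → A → Q) (S : Set Q) (w : List A) : Set Q :=
  (fun q => stepWordC δc q w) '' S

end Defs

section Words

variable {Q A : Type*} {δ : Q → A → Option Q}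

theorem stepWord_append (q : Q) (u w : List A) :
    stepWord δ q (u ++ w) = (stepWord δ q u).bind (fun p => stepWord δ p w) := by
  induction u generalizing q with
  | nil => simp [stepWord]
  | cons a u ih =>
    simp only [List.cons_append, stepWord]
    cases δ q a <;> simp [ih]

theorem stepWord_append_of_eq {p q : Q} {u : List A} (h : stepWord δ q u = some p) (w : List A) :
    stepWord δ q (u ++ w) = stepWord δ p w := by
  simp [stepWord_append, h]

theorem stepWordC_append (δc : Q → A → Q) (q : Q) (u w : List A) :
    stepWordC δc q (u ++ w) = stepWordC δc (stepWordC δc q u) w := by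
  simp [stepWordC]

theorem stepWordC_fixDelta_of_stepWord {p q : Q} {w : List A} (h : stepWord δ q w = some p) :
    stepWordC (fixDelta δ) q w = p := by
  induction w generalizing q with
  | nil => simpa [stepWord, stepWordC] using h
  | cons a w ih =>
    simp only [stepWord, Option.bind_eq_some_iff] at h
    obtain ⟨q', hq, h⟩ := h
    simpa [stepWordC, fixDelta, hq] using ih h

theorem img_append (S : Set Q) (u w : List A) : img δ S (u ++ w) = img δ (img δ S u) w := by
  ext p
  simp only [img, Set.mem_ofPred_eq, stepWord_append, Option.bind_eq_some_iff]
  constructor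
  · rintro ⟨q, hq, x, hx, h⟩
    exact ⟨x, ⟨q, hq, hx⟩, h⟩
  · rintro ⟨x, ⟨q, hq, hx⟩, h⟩
    exact ⟨q, hq, x, hx, h⟩

theorem img_mono {S T : Set Q} (h : S ⊆ T) (w : List A) : img δ S w ⊆ img δ T w := by
  rintro p ⟨q, hq, hp⟩
  exact ⟨q, h hq, hp⟩

theorem img_subset_imgC (S : Set Q) (w : List A) : img δ S w ⊆ imgC (fixDelta δ) S w := by
  rintro p ⟨q, hq, hp⟩
  exact ⟨q, hq, stepWordC_fixDelta_of_stepWord hp⟩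

theorem Insep.symm {p q : Q} (h : Insep δ p q) : Insep δ q p := fun u => (h u).symm

theorem Insep.trans {p q s : Q} (h : Insep δ p q) (h' : Insep δ q s) : Insep δ p s :=
  fun u => (h u).trans (h' u)

theorem Insep.of_stepWord {p q p' q' : Q} (h : Insep δ p q) {u : List A}
    (hp : stepWord δ p u = some p') (hq : stepWord δ q u = some q') : Insep δ p' q' := by
  intro v
  have := h (u ++ v)
  rwa [stepWord_append_of_eq hp, stepWord_append_of_eq hq] at this

theorem Insep.exists_stepWord {p q p' : Q} (h : Insep δ p q) {u : List A}
    (hp : stepWord δ p u = some p') : ∃ q', stepWord δ q u = some q' ∧ Insep δ p' q' := by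
  have hq : (stepWord δ q u).isSome := (h u).1 (by simp [hp])
  obtain ⟨q', hq⟩ := Option.isSome_iff_exists.1 hq
  exact ⟨q', hq, h.of_stepWord hp hq⟩

/-- On an inseparability class, every word of the fixing automaton can be simulated by a word
of the partial automaton. -/
theorem exists_word_simulating_on_class (w : List A) (c : Q) :
    ∃ w' : List A, ∀ p, Insep δ c p →
      stepWord δ p w' = some (stepWordC (fixDelta δ) p w) := by
  induction w generalizing c with
  | nil => exact ⟨[], fun p _ => by simp [stepWord, stepWordC]⟩
  | cons a w ih =>
    cases hc : δ c a with
    | none =>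
      obtain ⟨w', hw'⟩ := ih c
      refine ⟨w', fun p hp => ?_⟩
      have hpa : δ p a = none := by
        have := hp [a]
        simpa [stepWord, hc] using this
      simpa [stepWordC, fixDelta, hpa] using hw' p hp
    | some c' =>
      obtain ⟨w', hw'⟩ := ih c'
      refine ⟨a :: w', fun p hp => ?_⟩
      have hca : stepWord δ c [a] = some c' := by simp [stepWord, hc]
      obtain ⟨p', hp', hcp⟩ := hp.exists_stepWord hca
      have hpa : δ p a = some p' := by simpa [stepWord] using hp'
      simpa [stepWord, stepWordC, fixDelta, hpa] using hw' p' hcp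

theorem Insep.stepWordC_fixDelta {p q : Q} (h : Insep δ p q) (w : List A) :
    Insep δ (stepWordC (fixDelta δ) p w) (stepWordC (fixDelta δ) q w) := by
  obtain ⟨w', hw'⟩ := exists_word_simulating_on_class w p
  exact h.of_stepWord (hw' p fun _ => Iff.rfl) (hw' q h)

/-- Deleting from `w` the letters that are undefined on the whole current set yields a word with
a nonempty image inside the image of `w` in the fixing automaton. -/
theorem exists_word_img_subset_imgC (w : List A) (T : Set Q) (hT : T.Nonempty) :
    ∃ w' : List A, w'.length ≤ w.length ∧ (img δ T w').Nonempty ∧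
      img δ T w' ⊆ imgC (fixDelta δ) T w := by
  induction w generalizing T with
  | nil =>
    obtain ⟨t, ht⟩ := hT
    exact ⟨[], le_rfl, ⟨t, t, ht, rfl⟩, img_subset_imgC T []⟩
  | cons a w ih =>
    by_cases h : (img δ T [a]).Nonempty
    · obtain ⟨w', hl, hne, hsub⟩ := ih _ h
      refine ⟨[a] ++ w', by simpa using hl, by rwa [img_append], ?_⟩
      rw [img_append]
      refine hsub.trans ?_
      rintro p ⟨q, hq, rfl⟩
      obtain ⟨t, ht, rfl⟩ := img_subset_imgC T [a] hq
      exact ⟨t, ht, by simp [stepWordC]⟩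
    · obtain ⟨w', hl, hne, hsub⟩ := ih T hT
      refine ⟨w', hl.trans (by simp), hne, fun p hp => ?_⟩
      obtain ⟨t, ht, rfl⟩ := hsub hp
      have hta : δ t a = none := by
        by_contra hta
        obtain ⟨x, hx⟩ := Option.ne_none_iff_exists'.1 hta
        exact h ⟨x, t, ht, by simp [stepWord, hx]⟩
      exact ⟨t, ht, by simp [stepWordC, fixDelta, hta]⟩

end Words

section Separation

variable {Q A : Type*}

/-- Inseparability by words of length at most `k`. -/
def insepUpTo (δ : Q → A → Option Q) (k : ℕ) : Setoid Q where
  r p q := ∀ u : List A, u.length ≤ k → ((stepWord δ p u).isSome ↔ (stepWord δ q u).isSome)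
  iseqv := ⟨fun _ _ _ => Iff.rfl, fun h u hu => (h u hu).symm,
    fun h h' u hu => (h u hu).trans (h' u hu)⟩

variable {δ : Q → A → Option Q}

theorem insepUpTo_antitone : Antitone (insepUpTo δ) :=
  fun _ _ hkl _ _ h u hu => h u (hu.trans hkl)

theorem insepUpTo_succ_le_of_le {k : ℕ} (h : insepUpTo δ k ≤ insepUpTo δ (k + 1)) :
    insepUpTo δ (k + 1) ≤ insepUpTo δ (k + 2) := by
  intro p q hpq u hu
  cases u with
  | nil => simp [stepWord]
  | cons a u =>
    have ha := hpq [a] (by simp)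
    cases hp : δ p a with
    | none =>
      have hq : δ q a = none := by simpa [stepWord, hp] using ha
      simp [stepWord, hp, hq]
    | some p' =>
      obtain ⟨q', hq⟩ : ∃ q', δ q a = some q' := by
        rw [← Option.isSome_iff_exists]
        simpa [stepWord, hp] using ha
      have hpq' : insepUpTo δ k p' q' := by
        intro v hv
        have := hpq (a :: v) (by simpa using hv)
        simpa [stepWord, hp, hq] using this
      have := h hpq' u (by simpa using hu)
      simpa [stepWord, hp, hq] using this

theorem card_quotient_lt_of_lt [Finite Q] {s t : Setoid Q} (hle : t ≤ s) (hne : ¬ s ≤ t) :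
    Nat.card (Quotient s) < Nat.card (Quotient t) := by
  let f : Quotient t → Quotient s := Quotient.map id fun _ _ h => hle h
  have hf : Function.Surjective f := by
    rintro ⟨x⟩
    exact ⟨⟦x⟧, rfl⟩
  refine lt_of_le_of_ne (Nat.card_le_card_of_surjective f hf) fun hcard => hne fun p q hpq => ?_
  have hinj : Function.Injective f :=
    ((Nat.bijective_iff_surjective_and_card f).2 ⟨hf, hcard.symm⟩).1
  exact Quotient.exact (hinj (Quotient.sound hpq : f ⟦p⟧ = f ⟦q⟧))

theorem insepUpTo_stable_or_lt_card [Finite Q] [Nonempty Q] (k : ℕ) :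
    insepUpTo δ k ≤ insepUpTo δ (k + 1) ∨ k + 1 < Nat.card (Quotient (insepUpTo δ (k + 1))) := by
  induction k with
  | zero =>
    by_cases h : insepUpTo δ 0 ≤ insepUpTo δ 1
    · exact Or.inl h
    · refine Or.inr (lt_of_le_of_lt ?_ (card_quotient_lt_of_lt
        (insepUpTo_antitone (Nat.le_succ 0)) h))
      have : Nonempty (Quotient (insepUpTo δ 0)) := Nonempty.map (Quotient.mk _) ‹Nonempty Q›
      exact Nat.card_pos
  | succ k ih =>
    rcases ih with ih | ih
    · exact Or.inl (insepUpTo_succ_le_of_le ih)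
    · by_cases h : insepUpTo δ (k + 1) ≤ insepUpTo δ (k + 2)
      · exact Or.inl h
      · exact Or.inr (lt_of_le_of_lt ih (card_quotient_lt_of_lt
          (insepUpTo_antitone (Nat.le_succ (k + 1))) h))

theorem insepUpTo_card_le [Finite Q] [Nonempty Q] (k : ℕ) :
    insepUpTo δ (Nat.card Q - 1) ≤ insepUpTo δ (Nat.card Q - 1 + k) := by
  have hpos : 0 < Nat.card Q := Nat.card_pos
  have hstable : ∀ j, insepUpTo δ (Nat.card Q - 1 + j) ≤ insepUpTo δ (Nat.card Q - 1 + j + 1) := by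
    intro j
    induction j with
    | zero =>
      refine (insepUpTo_stable_or_lt_card _).resolve_right fun h => ?_
      have := Nat.card_le_card_of_surjective (Quotient.mk (insepUpTo δ (Nat.card Q - 1 + 0 + 1)))
        Quotient.mk_surjective
      omega
    | succ j ih => exact insepUpTo_succ_le_of_le ih
  induction k with
  | zero => exact le_rfl
  | succ k ih => exact ih.trans (hstable k)

/-- Separable states are separated by a word shorter than the number of states. -/
theorem exists_short_separating_word [Finite Q] [Nonempty Q] {p q : Q} (h : ¬ Insep δ p q) :
    ∃ u : List A, u.length ≤ Nat.card Q - 1 ∧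
      ¬ ((stepWord δ p u).isSome ↔ (stepWord δ q u).isSome) := by
  by_contra! hcon
  refine h fun u => ?_
  exact insepUpTo_card_le u.length (fun v hv => hcon v hv) u (by omega)

end Separation

section Rank

variable {Q A : Type*} [Finite Q] {δ : Q → A → Option Q}

theorem ncard_img_le (S : Set Q) (w : List A) : (img δ S w).ncard ≤ S.ncard :=
  (Set.ncard_le_ncard (img_subset_imgC S w)).trans (Set.ncard_image_le)

theorem ncard_img_add_le {S K : Set Q} {w : List A} (hK : K ⊆ S)
    (h : ∀ p ∈ K, stepWord δ p w = none) : (img δ S w).ncard + K.ncard ≤ S.ncard := by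
  have hsub : img δ S w ⊆ img δ (S \ K) w := by
    rintro p ⟨q, hq, hp⟩
    refine ⟨q, ⟨hq, fun hqK => ?_⟩, hp⟩
    simp [h q hqK] at hp
  have h1 := (Set.ncard_le_ncard hsub).trans (ncard_img_le (S \ K) w)
  have h2 := Set.ncard_sdiff_add_ncard_of_subset hK
  omega

/-- An image of minimal non-zero rank lies in a single inseparability class. -/
theorem insep_of_ncard_minimal {S : Set Q}
    (hmin : ∀ w : List A, (img δ S w).Nonempty → S.ncard ≤ (img δ S w).ncard)
    {p q : Q} (hp : p ∈ S) (hq : q ∈ S) : Insep δ p q := by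
  have key : ∀ {p q : Q}, p ∈ S → q ∈ S → ∀ u : List A,
      (stepWord δ p u).isSome → (stepWord δ q u).isSome := by
    intro p q hp hq u hpu
    by_contra hqu
    obtain ⟨p', hp'⟩ := Option.isSome_iff_exists.1 hpu
    have h1 := hmin u ⟨p', p, hp, hp'⟩
    have h2 := ncard_img_add_le (δ := δ) (S := S) (K := {q}) (w := u) (by simpa using hq)
      (by simpa using hqu)
    rw [Set.ncard_singleton] at h2
    omega
  exact fun u => ⟨key hp hq u, key hq hp u⟩

/-- A set on which the fixing automaton acts injectively and whose inseparability blocks all have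
at least `m` elements can be brought into a single inseparability class by a short word. -/
theorem exists_short_word_into_class [Nonempty Q] {m : ℕ} (N : ℕ) (U : Set Q) (hN : U.ncard ≤ N)
    (hm : 0 < m) (hU : U.Nonempty)
    (hinj : ∀ x : List A, Set.InjOn (fun q => stepWordC (fixDelta δ) q x) U)
    (hblock : ∀ x ∈ U, m ≤ {y ∈ U | Insep δ x y}.ncard) :
    ∃ u : List A, (img δ U u).Nonempty ∧ (∀ p ∈ img δ U u, ∀ q ∈ img δ U u, Insep δ p q) ∧
      u.length * m + m * (Nat.card Q - 1) ≤ U.ncard * (Nat.card Q - 1) := by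
  induction N generalizing U with
  | zero =>
    have := (Set.ncard_pos).2 hU
    omega
  | succ N ih =>
    by_cases hall : ∀ p ∈ U, ∀ q ∈ U, Insep δ p q
    · have hnil : img δ U [] = U := by
        ext p
        simp [img, stepWord]
      refine ⟨[], by rwa [hnil], by rwa [hnil], ?_⟩
      obtain ⟨x, hx⟩ := hU
      have := (hblock x hx).trans (Set.ncard_le_ncard (Set.sep_subset U _))
      simpa using Nat.mul_le_mul_right _ this
    · obtain ⟨p, hp, q, hq, u, hu, ⟨p', hpu⟩, hqu⟩ : ∃ p ∈ U, ∃ q ∈ U, ∃ u : List A,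
          u.length ≤ Nat.card Q - 1 ∧ (∃ p', stepWord δ p u = some p') ∧
          stepWord δ q u = none := by
        push Not at hall
        obtain ⟨p, hp, q, hq, hpq⟩ := hall
        obtain ⟨u, hu, hsep⟩ := exists_short_separating_word hpq
        cases hpu : stepWord δ p u with
        | none =>
          cases hqu : stepWord δ q u with
          | none => simp [hpu, hqu] at hsep
          | some q' => exact ⟨q, hq, p, hp, u, hu, ⟨q', hqu⟩, hpu⟩
        | some p' =>
          cases hqu : stepWord δ q u with
          | none => exact ⟨p, hp, q, hq, u, hu, ⟨p', hpu⟩, hqu⟩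
          | some q' => simp [hpu, hqu] at hsep
      have hdrop : (img δ U u).ncard + m ≤ U.ncard := by
        have hK := ncard_img_add_le (δ := δ) (S := U) (K := {y ∈ U | Insep δ q y}) (w := u)
          (Set.sep_subset U _) fun y hy => by
            have := hy.2 u
            simpa [hqu] using this
        have := hblock q hq
        omega
      obtain ⟨v, hne, hins, hlen⟩ := ih (img δ U u) (by omega) ⟨p', p, hp, hpu⟩
        (by
          rintro x _ ⟨s, hs, hsu⟩ _ ⟨t, ht, htu⟩ hst
          have hs' := stepWordC_fixDelta_of_stepWord hsu
          have ht' := stepWordC_fixDelta_of_stepWord htu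
          have : s = t := hinj (u ++ x) hs ht (by
            simpa only [stepWordC_append, hs', ht'] using hst)
          subst this
          simpa [hsu] using htu)
        (by
          rintro x ⟨s, hs, hsu⟩
          refine (hblock s hs).trans ?_
          have hinj' : Set.InjOn (fun q => stepWordC (fixDelta δ) q u) {y ∈ U | Insep δ s y} :=
            (hinj u).mono (Set.sep_subset U _)
          rw [← hinj'.ncard_image]
          refine Set.ncard_le_ncard ?_
          rintro _ ⟨y, ⟨hyU, hsy⟩, rfl⟩
          obtain ⟨y', hy', hxy⟩ := hsy.exists_stepWord hsu
          simp only [stepWordC_fixDelta_of_stepWord hy']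
          exact ⟨⟨y, hyU, hy'⟩, hxy⟩)
      refine ⟨u ++ v, by rwa [img_append], by rwa [img_append], ?_⟩
      rw [List.length_append]
      have h1 := Nat.mul_le_mul_right (Nat.card Q - 1) hdrop
      have h2 := Nat.mul_le_mul_right m hu
      nlinarith

end Rank

theorem sq_sub_add_le_sq_sub {n r s l : ℕ} (hs : 0 < s) (hsr : s ≤ r) (hrn : r ≤ n)
    (hl : l * s + s * (n - 1) ≤ r * (n - 1)) : (n - r) ^ 2 + l ≤ (n - s) ^ 2 := by
  obtain ⟨a, rfl⟩ := Nat.exists_eq_add_of_le hsr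
  obtain ⟨b, rfl⟩ := Nat.exists_eq_add_of_le hrn
  obtain ⟨t, rfl⟩ := Nat.exists_eq_add_of_le' hs
  have e1 : t + 1 + a + b - (t + 1 + a) = b := by omega
  have e2 : t + 1 + a + b - (t + 1) = a + b := by omega
  have e3 : t + 1 + a + b - 1 = t + a + b := by omega
  rw [e3] at hl
  rw [e1, e2]
  have h1 : l * (t + 1) ≤ a * (a + b) * (t + 1) := by
    rcases Nat.eq_zero_or_pos a with rfl | ha
    · nlinarith
    · have : t + a + b ≤ (a + b) * (t + 1) := by nlinarith
      nlinarith [Nat.mul_le_mul_left a this]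
  have h2 := Nat.le_of_mul_le_mul_right h1 (Nat.succ_pos t)
  nlinarith

/-- For a strongly connected partial DFA `A`, if the rank conjecture holds
for the fixing automaton `A^F` (a word of the minimal rank `r` of `A^F` of length at most
`(n − r)²` exists), then it holds for `A` (a word of the minimal non-zero rank `r'` of `A`
of length at most `(n − r')²` exists). -/
theorem stmt6 {Q A : Type*} [Fintype Q] [Nonempty Q] (δ : Q → A → Option Q)
    (hsc : StronglyConnected δ) (n r r' : ℕ) (hn : n = Fintype.card Q)
    (hr : r = sInf {k : ℕ | ∃ w : List A, (imgC (fixDelta δ) Set.univ w).ncard = k})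
    (hr' : r' = sInf {k : ℕ | ∃ w : List A, (img δ Set.univ w).ncard = k ∧ k ≠ 0})
    (hyp : ∃ w : List A, (imgC (fixDelta δ) Set.univ w).ncard = r ∧ w.length ≤ (n - r) ^ 2) :
    ∃ w : List A, (img δ Set.univ w).ncard = r' ∧ w.length ≤ (n - r') ^ 2 := by
  obtain ⟨w, hw, hwlen⟩ := hyp
  have hrmin : ∀ x : List A, r ≤ (imgC (fixDelta δ) Set.univ x).ncard := fun x => by
    rw [hr]
    exact Nat.sInf_le ⟨x, rfl⟩
  have hrmin' : ∀ x : List A, (img δ Set.univ x).Nonempty → r' ≤ (img δ Set.univ x).ncard :=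
    fun x hx => by
      rw [hr']
      exact Nat.sInf_le ⟨x, rfl, ((Set.ncard_pos).2 hx).ne'⟩
  obtain ⟨v, hv, hr0⟩ : ∃ v : List A, (img δ Set.univ v).ncard = r' ∧ r' ≠ 0 := by
    have hne : {k : ℕ | ∃ w : List A, (img δ Set.univ w).ncard = k ∧ k ≠ 0}.Nonempty := by
      obtain ⟨q⟩ := ‹Nonempty Q›
      have hnil : (img δ Set.univ []).Nonempty := ⟨q, q, trivial, rfl⟩
      exact ⟨_, [], rfl, ((Set.ncard_pos).2 hnil).ne'⟩
    have := Nat.sInf_mem hne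
    rwa [← hr'] at this
  have hvne : (img δ Set.univ v).Nonempty := (Set.ncard_pos).1 (by omega)
  have hvins : ∀ p ∈ img δ Set.univ v, ∀ q ∈ img δ Set.univ v, Insep δ p q :=
    fun p hp q hq => insep_of_ncard_minimal (fun x hx => by
      rw [← img_append] at hx ⊢
      exact hv.le.trans (hrmin' _ hx)) hp hq
  set R := imgC (fixDelta δ) Set.univ w with hR
  have hinj : ∀ x : List A, Set.InjOn (fun q => stepWordC (fixDelta δ) q x) R := by
    intro x
    refine Set.injOn_of_ncard_image_eq (le_antisymm Set.ncard_image_le ?_)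
    refine hw.le.trans ((hrmin (w ++ x)).trans (Set.ncard_le_ncard ?_))
    rintro _ ⟨q, -, rfl⟩
    exact ⟨_, ⟨q, trivial, rfl⟩, (stepWordC_append _ q w x).symm⟩
  have hblock : ∀ x ∈ R, r' ≤ {y ∈ R | Insep δ x y}.ncard := by
    rintro _ ⟨c, -, rfl⟩
    obtain ⟨s, hs⟩ := hvne
    obtain ⟨z, hz⟩ := hsc s c
    obtain ⟨w', hw'⟩ := exists_word_simulating_on_class (δ := δ) w c
    have hcw := hw' c fun _ => Iff.rfl
    refine (hrmin' (v ++ (z ++ w')) ?_).trans (Set.ncard_le_ncard ?_)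
    · rw [img_append]
      exact ⟨_, s, hs, (stepWord_append_of_eq hz w').trans hcw⟩
    · rw [img_append]
      rintro y ⟨t, ht, hty⟩
      obtain ⟨d, hd, hcd⟩ := (hvins s hs t ht).exists_stepWord hz
      rw [stepWord_append_of_eq hd, hw' d hcd] at hty
      obtain rfl := Option.some.inj hty
      exact ⟨⟨d, trivial, rfl⟩, hcd.stepWordC_fixDelta w⟩
  obtain ⟨w', hwlen', hne, hsub⟩ := exists_word_img_subset_imgC (δ := δ) w Set.univ Set.univ_nonempty
  set T := img δ Set.univ w' with hT
  set U := {x ∈ R | ∃ t ∈ T, Insep δ t x} with hU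
  have hTU : T ⊆ U := fun t ht => ⟨hsub ht, t, ht, fun _ => Iff.rfl⟩
  have hUR : U ⊆ R := Set.sep_subset R _
  obtain ⟨u, hune, huins, hulen⟩ := exists_short_word_into_class (δ := δ) (m := r') U.ncard U le_rfl
    (Nat.pos_of_ne_zero hr0) (hne.mono hTU) (fun x => (hinj x).mono hUR) (by
      rintro x ⟨hxR, t, ht, htx⟩
      refine (hblock x hxR).trans (Set.ncard_le_ncard ?_)
      rintro y ⟨hyR, hxy⟩
      exact ⟨⟨hyR, t, ht, htx.trans hxy⟩, hxy⟩)
  have hSU : img δ T u ⊆ img δ U u := img_mono hTU u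
  have hSne : (img δ T u).Nonempty := by
    obtain ⟨_, x, ⟨-, t, ht, htx⟩, hxu⟩ := hune
    obtain ⟨t', ht', -⟩ := htx.symm.exists_stepWord hxu
    exact ⟨t', t, ht, ht'⟩
  have hSr : (img δ T u).ncard ≤ r' := by
    obtain ⟨s, hs⟩ := hSne
    obtain ⟨_, q, -, hqv⟩ := hvne
    obtain ⟨z, hz⟩ := hsc s q
    have hszv := (stepWord_append_of_eq hz v).trans hqv
    have hinjS : Set.InjOn (fun q => stepWordC (fixDelta δ) q (z ++ v)) (img δ T u) := by
      rintro _ ⟨a, ha, hau⟩ _ ⟨b, hb, hbu⟩ hab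
      have ha' := stepWordC_fixDelta_of_stepWord hau
      have hb' := stepWordC_fixDelta_of_stepWord hbu
      have : a = b := hinj (u ++ (z ++ v)) (hUR (hTU ha)) (hUR (hTU hb)) (by
        simpa only [stepWordC_append, ha', hb'] using hab)
      subst this
      simpa [hau] using hbu
    rw [← hinjS.ncard_image, ← hv]
    refine Set.ncard_le_ncard ?_
    rintro _ ⟨t, ht, rfl⟩
    obtain ⟨t', ht', -⟩ := (huins s (hSU hs) t (hSU ht)).exists_stepWord hszv
    simp only [stepWordC_fixDelta_of_stepWord ht']
    rw [stepWord_append, Option.bind_eq_some_iff] at ht'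
    obtain ⟨y, -, hy⟩ := ht'
    exact ⟨y, trivial, hy⟩
  refine ⟨w' ++ u, le_antisymm ?_ ?_, ?_⟩
  · rwa [img_append]
  · exact hrmin' _ (by rwa [img_append])
  · have hrn : r ≤ n := by
      rw [← hw, hn, ← Nat.card_eq_fintype_card]
      exact Set.ncard_le_card R
    have hrr : r' ≤ r := by
      obtain ⟨x, hx⟩ := hne
      exact (hblock x (hsub hx)).trans ((Set.ncard_le_ncard (Set.sep_subset R _)).trans hw.le)
    have hUr : U.ncard ≤ r := (Set.ncard_le_ncard hUR).trans hw.le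
    rw [Nat.card_eq_fintype_card, ← hn] at hulen
    have := sq_sub_add_le_sq_sub (Nat.pos_of_ne_zero hr0) hrr hrn
      (hulen.trans (Nat.mul_le_mul_right _ hUr))
    rw [List.length_append]
    omega
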